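/- The Lagrange multiplier l := 2 ∫_{-∞}^{∞} log|2 − s| ψ(s) ds equals 1, where ψ is the equilibrium density. -/

import Mathlib

open Real MeasureTheory

/-- The equilibrium density for the rescaled Tricomi-Carlitz polynomials. -/
noncomputable def psiTC (x : ℝ) : ℝ :=
  if |x| < 2 then
    (1 / π) * (4 * Real.arctan (|x| / Real.sqrt (4 - x ^ 2)) / |x| ^ 3
      - Real.sqrt (4 - x ^ 2) / x ^ 2)
  else 2 / |x| ^ 3

open Set Filter Topology

lemma psiTC_neg (x : ℝ) : psiTC (-x) = psiTC x := by
  simp [psiTC]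

lemma psiTC_of_two_lt {x : ℝ} (hx : 2 < x) : psiTC x = 2 / x ^ 3 := by
  have h : |x| = x := abs_of_pos (by linarith)
  rw [psiTC, h, if_neg (by linarith)]

lemma measurable_psiTC : Measurable psiTC := by
  unfold psiTC
  refine Measurable.ite (measurableSet_lt (by fun_prop) (by fun_prop)) ?_ ?_
  · exact (((Real.measurable_arctan.comp (by fun_prop)).const_mul 4).div (by fun_prop)).sub
      (by fun_prop) |>.const_mul _
  · fun_prop

lemma psiTC_two_mul_sin {θ : ℝ} (h0 : 0 < θ) (h1 : θ < π / 2) :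
    psiTC (2 * sin θ) = (1 / π) * ((θ - sin θ * cos θ) / (2 * sin θ ^ 3)) := by
  have hs : 0 < sin θ := sin_pos_of_pos_of_lt_pi h0 (by linarith [pi_pos])
  have hc : 0 < cos θ := cos_pos_of_mem_Ioo ⟨by linarith, h1⟩
  have hs1 : sin θ < 1 := by nlinarith [sin_sq_add_cos_sq θ]
  have habs : |2 * sin θ| = 2 * sin θ := abs_of_pos (by linarith)
  have hsqrt : √(4 - (2 * sin θ) ^ 2) = 2 * cos θ := by
    rw [show 4 - (2 * sin θ) ^ 2 = (2 * cos θ) ^ 2 by linarith [sin_sq_add_cos_sq θ]]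
    exact Real.sqrt_sq (by linarith)
  have htan : 2 * sin θ / (2 * cos θ) = tan θ := by
    rw [tan_eq_sin_div_cos]; field_simp
  rw [psiTC, habs, if_pos (by linarith), hsqrt, htan, arctan_tan (by linarith) h1]
  field_simp
  ring

lemma mul_cos_le_sin {θ : ℝ} (h0 : 0 ≤ θ) (h1 : θ < π / 2) : θ * cos θ ≤ sin θ := by
  have hc : 0 < cos θ := cos_pos_of_mem_Ioo ⟨by linarith, h1⟩
  have h := le_tan h0 h1
  rwa [tan_eq_sin_div_cos, le_div_iff₀ hc] at h

lemma sin_mul_cos_le {θ : ℝ} (h0 : 0 ≤ θ) : sin θ * cos θ ≤ θ := by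
  have h := sin_le (x := 2 * θ) (by linarith)
  rw [sin_two_mul] at h
  linarith

lemma sub_sin_mul_cos_le {θ : ℝ} (h0 : 0 ≤ θ) (h1 : θ < π / 2) :
    θ - sin θ * cos θ ≤ π / 2 * sin θ ^ 3 := by
  have hc : 0 < cos θ := cos_pos_of_mem_Ioo ⟨by linarith, h1⟩
  have hJ : θ ≤ π / 2 * sin θ := by
    have h := mul_le_sin h0 h1.le
    have hp := pi_pos
    rw [div_mul_eq_mul_div, div_le_iff₀ hp] at h
    linarith
  calc θ - sin θ * cos θ
      = (θ * cos θ - sin θ) * cos θ + θ * sin θ ^ 2 := by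
        rw [sin_sq]; ring
    _ ≤ 0 + π / 2 * sin θ * sin θ ^ 2 :=
        add_le_add (mul_nonpos_of_nonpos_of_nonneg
          (sub_nonpos.2 (mul_cos_le_sin h0 h1)) hc.le)
          (mul_le_mul_of_nonneg_right hJ (sq_nonneg _))
    _ = π / 2 * sin θ ^ 3 := by ring

lemma image_two_mul_sin : (fun θ => 2 * sin θ) '' Ioo 0 (π / 2) = Ioo 0 2 := by
  ext x
  constructor
  · rintro ⟨θ, ⟨h0, h1⟩, rfl⟩
    have hs : 0 < sin θ := sin_pos_of_pos_of_lt_pi h0 (by linarith [pi_pos])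
    have hc : 0 < cos θ := cos_pos_of_mem_Ioo ⟨by linarith, h1⟩
    have hs1 : sin θ < 1 := by nlinarith [sin_sq_add_cos_sq θ]
    exact ⟨by linarith, by linarith⟩
  · rintro ⟨h0, h2⟩
    refine ⟨arcsin (x / 2), ⟨arcsin_pos.2 (by linarith), ?_⟩, ?_⟩
    · exact arcsin_lt_pi_div_two.2 (by linarith)
    · simp only
      rw [sin_arcsin (by linarith) (by linarith)]
      ring

lemma abs_psiTC_le (x : ℝ) : |psiTC x| ≤ 1 / 4 := by
  wlog hx : 0 ≤ x generalizing x
  · rw [← psiTC_neg]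
    exact this (-x) (by linarith)
  rcases hx.eq_or_lt with rfl | hx
  · simp [psiTC]
  rcases lt_or_ge x 2 with h2 | h2
  · obtain ⟨θ, ⟨h0, h1⟩, rfl⟩ := image_two_mul_sin.ge (⟨hx, h2⟩ : x ∈ Ioo (0 : ℝ) 2)
    have hs : 0 < sin θ := sin_pos_of_pos_of_lt_pi h0 (by linarith [pi_pos])
    have hp := pi_pos
    simp only
    rw [psiTC_two_mul_sin h0 h1, abs_of_nonneg]
    · rw [div_mul_div_comm, one_mul, div_le_div_iff₀ (by positivity) (by norm_num)]
      nlinarith [sub_sin_mul_cos_le h0.le h1]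
    · have := sub_nonneg.2 (sin_mul_cos_le h0.le)
      positivity
  · have h : |x| = x := abs_of_pos hx
    rw [psiTC, h, if_neg (by linarith), abs_of_nonneg (by positivity),
      div_le_div_iff₀ (by positivity) (by norm_num)]
    nlinarith [pow_le_pow_left₀ (by norm_num : (0 : ℝ) ≤ 2) h2 3]

lemma integrable_log_mul_psiTC : Integrable fun s : ℝ => log |2 - s| * psiTC s := by
  rw [← integrableOn_univ, ← union_compl_self (Icc (-4 : ℝ) 4)]
  refine IntegrableOn.union ?_ ?_
  · refine Integrable.mul_bdd (c := 1 / 4) ?_ measurable_psiTC.aestronglyMeasurable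
      (Eventually.of_forall abs_psiTC_le)
    have h := (intervalIntegral.intervalIntegrable_log' (a := -2) (b := 6)).comp_sub_left 2
    norm_num at h
    have h' := (intervalIntegrable_iff_integrableOn_Icc_of_le (by norm_num)).1 h.symm
    simpa [log_abs, IntegrableOn] using h'
  · have hm : Measurable fun s : ℝ => log |2 - s| * psiTC s :=
      Measurable.mul (by fun_prop) measurable_psiTC
    refine Integrable.mono' (integrable_inv_one_add_sq.const_mul 8).integrableOn
      hm.aestronglyMeasurable ?_
    refine (ae_restrict_mem measurableSet_Icc.compl).mono fun s hs => ?_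
    have hs4 : 4 < |s| := by
      by_contra! h
      exact hs (abs_le.1 h)
    have hlow : 1 ≤ |2 - s| := by
      have := abs_sub_abs_le_abs_sub s 2
      rw [abs_sub_comm, abs_two] at this
      linarith
    have hup : |2 - s| ≤ 2 * |s| := by
      have := abs_sub 2 s
      rw [abs_two] at this
      linarith
    have hlog : |(log |2 - s|)| ≤ 2 * |s| := by
      rw [abs_of_nonneg (log_nonneg hlow)]
      exact (log_le_self (abs_nonneg _)).trans hup
    have hpsi : |psiTC s| = 2 / |s| ^ 3 := by
      rw [psiTC, if_neg (by linarith), abs_of_nonneg (by positivity)]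
    rw [norm_mul, norm_eq_abs, norm_eq_abs, hpsi, ← sq_abs s]
    calc |(log |2 - s|)| * (2 / |s| ^ 3) ≤ 2 * |s| * (2 / |s| ^ 3) := by gcongr
      _ = 4 / |s| ^ 2 := by field_simp; ring
      _ ≤ 8 * (1 + |s| ^ 2)⁻¹ := by
        rw [← div_eq_mul_inv, div_le_div_iff₀ (by positivity) (by positivity)]
        nlinarith

lemma log_abs_add_log_abs {s : ℝ} (h0 : 0 < s) (h2 : s ≠ 2) :
    log |2 - s| + log |2 + s| = log |4 - s ^ 2| := by
  rw [← log_mul (abs_ne_zero.2 (sub_ne_zero.2 h2.symm)) (abs_ne_zero.2 (by positivity)), ← abs_mul]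
  ring_nf

lemma integrableOn_Ioi_log_mul_psiTC :
    IntegrableOn (fun s : ℝ => log |4 - s ^ 2| * psiTC s) (Ioi 0) := by
  have h := (integrable_log_mul_psiTC.add integrable_log_mul_psiTC.comp_neg).integrableOn
    (s := Ioi 0)
  refine h.congr ?_
  filter_upwards [ae_restrict_mem measurableSet_Ioi, ae_restrict_of_ae (Measure.ae_ne volume 2)]
    with s h0 h2
  simp only [Pi.add_apply, psiTC_neg, sub_neg_eq_add]
  rw [← log_abs_add_log_abs h0 h2]
  ring

lemma integral_log_mul_psiTC_eq :
    ∫ s : ℝ, log |2 - s| * psiTC s = ∫ s in Ioi 0, log |4 - s ^ 2| * psiTC s := by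
  have hint := integrable_log_mul_psiTC
  have hneg := integral_comp_neg_Ioi 0 fun s => log |2 - s| * psiTC s
  rw [neg_zero] at hneg
  rw [← intervalIntegral.integral_Iic_add_Ioi hint.integrableOn (b := 0) hint.integrableOn,
    ← hneg, ← integral_add hint.comp_neg.integrableOn hint.integrableOn]
  refine integral_congr_ae ?_
  filter_upwards [ae_restrict_mem measurableSet_Ioi, ae_restrict_of_ae (Measure.ae_ne volume 2)]
    with s h0 h2
  simp only [psiTC_neg, sub_neg_eq_add]
  rw [← log_abs_add_log_abs h0 h2]
  ring

lemma integral_Ioi_two_log_mul_psiTC :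
    ∫ s in Ioi 2, log |4 - s ^ 2| * psiTC s = log 2 / 2 := by
  have hint : IntegrableOn (fun s : ℝ => log |4 - s ^ 2| * psiTC s) (Ioi 2) :=
    integrableOn_Ioi_log_mul_psiTC.mono_set (Ioi_subset_Ioi (by norm_num))
  have hderiv : ∀ s ∈ Ioi (2 : ℝ), HasDerivAt
      (fun s : ℝ => (1 / 4 - 1 / s ^ 2) * log (s ^ 2 - 4) - log s / 2)
      (log |4 - s ^ 2| * psiTC s) s := by
    intro s hs
    have hs2 : (2 : ℝ) < s := hs
    have hs0 : s ≠ 0 := by linarith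
    have hpos : 0 < s ^ 2 - 4 := by nlinarith
    have h1 : HasDerivAt (fun s : ℝ => 1 / 4 - 1 / s ^ 2) (2 / s ^ 3) s := by
      have := (((hasDerivAt_pow 2 s).fun_inv (pow_ne_zero 2 hs0))).const_sub (1 / 4)
      simp only [← one_div] at this
      refine this.congr_deriv ?_
      field_simp
      norm_num
      ring
    have h2 : HasDerivAt (fun s : ℝ => log (s ^ 2 - 4)) (2 * s / (s ^ 2 - 4)) s := by
      have := (((hasDerivAt_id s).pow 2).sub_const 4).log hpos.ne'
      simpa using this
    refine ((h1.fun_mul h2).fun_sub ((hasDerivAt_log hs0).div_const 2)).congr_deriv ?_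
    rw [psiTC_of_two_lt hs2, abs_sub_comm, abs_of_pos hpos]
    field_simp [hpos.ne']
    ring
  have hcont : ContinuousWithinAt
      (fun s : ℝ => (1 / 4 - 1 / s ^ 2) * log (s ^ 2 - 4) - log s / 2) (Ici 2) 2 := by
    have hcont' : ContinuousAt
        (fun s : ℝ => (s ^ 2 - 4) * log (s ^ 2 - 4) / (4 * s ^ 2) - log s / 2) 2 := by
      refine ContinuousAt.sub (ContinuousAt.div ?_ (by fun_prop) (by norm_num)) ?_
      · exact (continuous_mul_log.comp
          (by fun_prop : Continuous fun s : ℝ => s ^ 2 - 4)).continuousAt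
      · exact (continuousAt_log (by norm_num)).div_const 2
    have heq : ∀ s ∈ Ici (2 : ℝ), (1 / 4 - 1 / s ^ 2) * log (s ^ 2 - 4) - log s / 2 =
        (s ^ 2 - 4) * log (s ^ 2 - 4) / (4 * s ^ 2) - log s / 2 := by
      intro s hs
      have hs0 : s ≠ 0 := by linarith [show (2 : ℝ) ≤ s from hs]
      field_simp
    exact hcont'.continuousWithinAt.congr heq (heq 2 self_mem_Ici)
  have htop : Tendsto (fun s : ℝ => (1 / 4 - 1 / s ^ 2) * log (s ^ 2 - 4) - log s / 2)
      atTop (𝓝 0) := by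
    have hinv : Tendsto (fun s : ℝ => 1 / s ^ 2) atTop (𝓝 0) := by
      simpa using (tendsto_pow_neg_atTop (𝕜 := ℝ) (n := 2) (by norm_num))
    have h1 : Tendsto (fun s : ℝ => log (1 - 4 * (1 / s ^ 2))) atTop (𝓝 0) := by
      have : Tendsto (fun s : ℝ => 1 - 4 * (1 / s ^ 2)) atTop (𝓝 1) := by
        simpa using (hinv.const_mul 4).const_sub 1
      simpa using this.log one_ne_zero
    have h2 : Tendsto (fun s : ℝ => log s / s ^ 2) atTop (𝓝 0) := by
      have := (isLittleO_log_id_atTop.tendsto_div_nhds_zero).mul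
        (tendsto_inv_atTop_zero (𝕜 := ℝ))
      rw [zero_mul] at this
      refine this.congr fun s => ?_
      simp only [id, div_eq_mul_inv, sq, mul_inv, mul_assoc]
    have h3 := ((hinv.const_sub (1 / 4)).mul h1).sub (h2.const_mul 2)
    simp only [mul_zero, sub_zero] at h3
    refine h3.congr' ?_
    filter_upwards [eventually_gt_atTop 2] with s hs
    have hs0 : s ≠ 0 := by linarith
    have hpos : 0 < s ^ 2 - 4 := by nlinarith
    have : 1 - 4 * (1 / s ^ 2) = (s ^ 2 - 4) / s ^ 2 := by field_simp
    rw [this, log_div hpos.ne' (by positivity), log_pow]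
    push_cast
    ring
  rw [integral_Ioi_of_hasDerivAt_of_tendsto hcont hderiv hint htop]
  norm_num

lemma hasDerivAt_two_mul_sin (θ : ℝ) : HasDerivAt (fun θ => 2 * sin θ) (2 * cos θ) θ :=
  (hasDerivAt_sin θ).const_mul 2

lemma injOn_two_mul_sin : InjOn (fun θ => 2 * sin θ) (Ioo 0 (π / 2)) := by
  intro a ha b hb h
  refine injOn_sin ⟨by linarith [ha.1, pi_pos], ha.2.le⟩ ⟨by linarith [hb.1, pi_pos], hb.2.le⟩ ?_
  simpa using h

/-- The integrand over `(0, 2)` after the substitution `s = 2 sin θ`. -/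
lemma substituted_integrand_eq {θ : ℝ} (hθ : θ ∈ Ioo 0 (π / 2)) :
    |2 * cos θ| • (log |4 - (2 * sin θ) ^ 2| * psiTC (2 * sin θ)) =
      2 / π * ((log 2 + log (cos θ)) * ((θ - sin θ * cos θ) * cos θ / sin θ ^ 3)) := by
  obtain ⟨h0, h1⟩ := hθ
  have hs : 0 < sin θ := sin_pos_of_pos_of_lt_pi h0 (by linarith [pi_pos])
  have hc : 0 < cos θ := cos_pos_of_mem_Ioo ⟨by linarith, h1⟩
  have hp := pi_pos
  rw [psiTC_two_mul_sin h0 h1, abs_of_pos (by positivity : 0 < 2 * cos θ),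
    show 4 - (2 * sin θ) ^ 2 = (2 * cos θ) ^ 2 by linarith [sin_sq_add_cos_sq θ],
    abs_of_nonneg (sq_nonneg _), log_pow, log_mul two_ne_zero hc.ne', smul_eq_mul]
  field_simp
  push_cast
  ring

lemma intervalIntegrable_substituted : IntervalIntegrable
    (fun θ => (log 2 + log (cos θ)) * ((θ - sin θ * cos θ) * cos θ / sin θ ^ 3))
    volume 0 (π / 2) := by
  rw [intervalIntegrable_iff_integrableOn_Ioo_of_le (by positivity)]
  have h : IntegrableOn (fun s : ℝ => log |4 - s ^ 2| * psiTC s)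
      ((fun θ => 2 * sin θ) '' Ioo 0 (π / 2)) := by
    rw [image_two_mul_sin]
    exact integrableOn_Ioi_log_mul_psiTC.mono_set Ioo_subset_Ioi_self
  rw [integrableOn_image_iff_integrableOn_abs_deriv_smul measurableSet_Ioo
    (fun θ _ => (hasDerivAt_two_mul_sin θ).hasDerivWithinAt) injOn_two_mul_sin] at h
  refine IntegrableOn.congr_fun (h.const_mul (π / 2)) (fun θ hθ => ?_) measurableSet_Ioo
  rw [substituted_integrand_eq hθ]
  field_simp

lemma integral_Ioo_log_mul_psiTC_eq :
    ∫ s in Ioo 0 2, log |4 - s ^ 2| * psiTC s = 2 / π * ∫ θ in (0)..(π / 2),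
      (log 2 + log (cos θ)) * ((θ - sin θ * cos θ) * cos θ / sin θ ^ 3) := by
  rw [← image_two_mul_sin, integral_image_eq_integral_abs_deriv_smul measurableSet_Ioo
    (fun θ _ => (hasDerivAt_two_mul_sin θ).hasDerivWithinAt) injOn_two_mul_sin,
    intervalIntegral.integral_of_le (by positivity), integral_Ioc_eq_integral_Ioo,
    ← integral_const_mul]
  exact setIntegral_congr_fun measurableSet_Ioo fun θ hθ => substituted_integrand_eq hθ

/-- The elementary part of an antiderivative of the substituted integrand. -/
noncomputable def trigPrimitive (θ : ℝ) : ℝ :=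
  log 2 * (π / 4 - (θ - sin θ * cos θ) / (2 * sin θ ^ 2))
    + cos θ * log (cos θ) * ((sin θ - θ * cos θ) / (2 * sin θ ^ 2)) - θ * log (sin θ) / 2

lemma hasDerivAt_trigPrimitive {θ : ℝ} (hθ : θ ∈ Ioo 0 (π / 2)) :
    HasDerivAt trigPrimitive
      ((log 2 + log (cos θ)) * ((θ - sin θ * cos θ) * cos θ / sin θ ^ 3)
        - (log 2 + 1 / 2 + log (cos θ) / 2 + log (sin θ) / 2)) θ := by
  obtain ⟨h0, h1⟩ := hθ
  have hs : 0 < sin θ := sin_pos_of_pos_of_lt_pi h0 (by linarith [pi_pos])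
  have hc : 0 < cos θ := cos_pos_of_mem_Ioo ⟨by linarith, h1⟩
  have dS := hasDerivAt_sin θ
  have dC := hasDerivAt_cos θ
  have dI := hasDerivAt_id' θ
  have hden : 2 * sin θ ^ 2 ≠ 0 := by positivity
  have dD := (dS.pow 2).const_mul 2
  have d1 := (((dI.sub (dS.mul dC)).div dD hden).const_sub (π / 4)).const_mul (log 2)
  have d2 := (dC.mul (dC.log hc.ne')).mul ((dS.sub (dI.mul dC)).div dD hden)
  have d3 := (dI.mul (dS.log hs.ne')).div_const 2
  refine ((d1.add d2).sub d3).congr_deriv ?_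
  have hsc : cos θ ^ 2 = 1 - sin θ ^ 2 := cos_sq' θ
  simp only [Pi.mul_apply, Pi.sub_apply, Pi.pow_apply, Pi.div_apply]
  norm_num only [Nat.cast_ofNat]
  field_simp
  linear_combination (log 2 * sin θ + 2 * log (cos θ) * cos θ * θ) * hsc

lemma tendsto_trigPrimitive_zero :
    Tendsto trigPrimitive (𝓝[>] 0) (𝓝 (log 2 * (π / 4))) := by
  have hp := pi_pos
  have hmem : ∀ᶠ θ : ℝ in 𝓝[>] 0, θ ∈ Ioo 0 (π / 2) := Ioo_mem_nhdsGT (by positivity)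
  have hsin : Tendsto sin (𝓝[>] 0) (𝓝 0) := by
    simpa using (continuous_sin.tendsto 0).mono_left nhdsWithin_le_nhds
  have t1 : Tendsto (fun θ => (θ - sin θ * cos θ) / (2 * sin θ ^ 2)) (𝓝[>] 0) (𝓝 0) := by
    refine squeeze_zero' (g := fun θ => π / 4 * sin θ) ?_ ?_ (by simpa using hsin.const_mul (π / 4))
    · filter_upwards [hmem] with θ hθ
      have := sub_nonneg.2 (sin_mul_cos_le hθ.1.le)
      positivity
    · filter_upwards [hmem] with θ hθ
      have hs : 0 < sin θ := sin_pos_of_pos_of_lt_pi hθ.1 (by linarith [hθ.2])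
      rw [div_le_iff₀ (by positivity)]
      linarith [sub_sin_mul_cos_le hθ.1.le hθ.2]
  have t2 : Tendsto (fun θ => (sin θ - θ * cos θ) / (2 * sin θ ^ 2)) (𝓝[>] 0) (𝓝 0) := by
    refine squeeze_zero' (g := fun θ => 1 / 2 * sin θ) ?_ ?_
      (by simpa using hsin.const_mul (1 / 2 : ℝ))
    · filter_upwards [hmem] with θ hθ
      have := sub_nonneg.2 (mul_cos_le_sin hθ.1.le hθ.2)
      positivity
    · filter_upwards [hmem] with θ hθ
      have hs : 0 < sin θ := sin_pos_of_pos_of_lt_pi hθ.1 (by linarith [hθ.2])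
      have hc : 0 < cos θ := cos_pos_of_mem_Ioo ⟨by linarith [hθ.1], hθ.2⟩
      rw [div_le_iff₀ (by positivity)]
      have h1 : sin θ * cos θ ≤ θ * cos θ := by gcongr; exact sin_le hθ.1.le
      have h2 : cos θ ^ 2 ≤ cos θ := by nlinarith [cos_le_one θ]
      have h3 : sin θ * (1 - cos θ) ≤ sin θ * sin θ ^ 2 := by
        gcongr
        linarith [sin_sq_add_cos_sq θ]
      linarith
  have t3 : Tendsto (fun θ => θ * log (sin θ)) (𝓝[>] 0) (𝓝 0) := by
    have hml : Tendsto (fun θ => sin θ * log (sin θ)) (𝓝[>] 0) (𝓝 0) := by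
      simpa [Function.comp_def] using (continuous_mul_log.tendsto 0).comp hsin
    refine squeeze_zero_norm' (a := fun θ => π / 2 * |sin θ * log (sin θ)|) ?_
      (by simpa using hml.abs.const_mul (π / 2))
    filter_upwards [hmem] with θ hθ
    have hs : 0 < sin θ := sin_pos_of_pos_of_lt_pi hθ.1 (by linarith [hθ.2])
    have hJ : θ ≤ π / 2 * sin θ := by
      have h := mul_le_sin hθ.1.le hθ.2.le
      rw [div_mul_eq_mul_div, div_le_iff₀ hp] at h
      linarith
    rw [norm_eq_abs, abs_mul, abs_mul, abs_of_pos hθ.1, abs_of_pos hs, ← mul_assoc]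
    gcongr
  have t4 : Tendsto (fun θ => cos θ * log (cos θ)) (𝓝[>] 0) (𝓝 0) := by
    have := ((continuous_mul_log.comp continuous_cos).tendsto 0).mono_left
      (nhdsWithin_le_nhds (s := Ioi 0))
    simpa [Function.comp_def] using this
  have := (((t1.const_sub (π / 4)).const_mul (log 2)).add (t4.mul t2)).sub (t3.div_const 2)
  simp only [sub_zero, mul_zero, zero_div, add_zero] at this
  exact this

lemma tendsto_trigPrimitive_pi_div_two :
    Tendsto trigPrimitive (𝓝[<] (π / 2)) (𝓝 0) := by
  have hcont : ContinuousAt trigPrimitive (π / 2) := by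
    have hden : 2 * sin (π / 2) ^ 2 ≠ 0 := by simp
    have hlog : ContinuousAt (fun θ => log (sin θ)) (π / 2) :=
      continuous_sin.continuousAt.log (by simp)
    have hml : ContinuousAt (fun θ => cos θ * log (cos θ)) (π / 2) :=
      (continuous_mul_log.comp continuous_cos).continuousAt
    have hd1 : ContinuousAt (fun θ => (θ - sin θ * cos θ) / (2 * sin θ ^ 2)) (π / 2) :=
      ContinuousAt.div (by fun_prop) (by fun_prop) hden
    have hd2 : ContinuousAt (fun θ => (sin θ - θ * cos θ) / (2 * sin θ ^ 2)) (π / 2) :=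
      ContinuousAt.div (by fun_prop) (by fun_prop) hden
    exact ((continuousAt_const.mul (continuousAt_const.sub hd1)).add (hml.mul hd2)).sub
      ((continuousAt_id.mul hlog).div_const 2)
  have hval : trigPrimitive (π / 2) = 0 := by
    simp [trigPrimitive]
    right; ring
  simpa [hval] using hcont.tendsto.mono_left (nhdsWithin_le_nhds (s := Iio (π / 2)))

lemma integral_log_cos_zero_pi_div_two :
    ∫ θ in (0)..(π / 2), log (cos θ) = -log 2 * π / 2 := by
  rw [← integral_log_sin_zero_pi_div_two]
  have := intervalIntegral.integral_comp_sub_left (a := 0) (b := π / 2)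
    (fun x => log (sin x)) (π / 2)
  simpa [sin_pi_div_two_sub] using this

lemma integral_substituted :
    ∫ θ in (0)..(π / 2), (log 2 + log (cos θ)) * ((θ - sin θ * cos θ) * cos θ / sin θ ^ 3) =
      π / 4 - log 2 * (π / 4) := by
  have hC : IntervalIntegrable (fun θ => log (cos θ)) volume 0 (π / 2) := intervalIntegrable_log_cos
  have hS : IntervalIntegrable (fun θ => log (sin θ)) volume 0 (π / 2) := intervalIntegrable_log_sin
  have hconst : IntervalIntegrable (fun _ : ℝ => log 2 + 1 / 2) volume 0 (π / 2) :=
    intervalIntegrable_const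
  have hR := (hconst.add (hC.div_const 2)).add (hS.div_const 2)
  have hF := intervalIntegral.integral_eq_sub_of_hasDerivAt_of_tendsto (by positivity)
    (fun θ hθ => hasDerivAt_trigPrimitive hθ) (intervalIntegrable_substituted.sub hR)
    tendsto_trigPrimitive_zero tendsto_trigPrimitive_pi_div_two
  rw [intervalIntegral.integral_sub intervalIntegrable_substituted hR,
    intervalIntegral.integral_add (hconst.add (hC.div_const 2)) (hS.div_const 2),
    intervalIntegral.integral_add hconst (hC.div_const 2),
    intervalIntegral.integral_div, intervalIntegral.integral_div,
    integral_log_cos_zero_pi_div_two, integral_log_sin_zero_pi_div_two,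
    intervalIntegral.integral_const, smul_eq_mul] at hF
  linarith

/-- The Lagrange multiplier `l := 2 ∫ log|2 − s| ψ(s) ds` equals `1`. -/
theorem lagrange_multiplier_eq_one :
    2 * ∫ s : ℝ, Real.log |2 - s| * psiTC s = 1 := by
  have hint := integrableOn_Ioi_log_mul_psiTC
  rw [integral_log_mul_psiTC_eq, ← Ioc_union_Ioi_eq_Ioi (zero_le_two (α := ℝ)),
    setIntegral_union (Ioc_disjoint_Ioi le_rfl) measurableSet_Ioi
      (hint.mono_set Ioc_subset_Ioi_self)
      (hint.mono_set (Ioi_subset_Ioi zero_le_two)),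
    integral_Ioi_two_log_mul_psiTC, integral_Ioc_eq_integral_Ioo,
    integral_Ioo_log_mul_psiTC_eq, integral_substituted]
  field_simp
  ring
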